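/- arXiv:math/0508230 — 3 statements merged into one kernel-verified Lean document; each statement's English description precedes it below -/
import Mathlib

section
/- Assume the EPCAG setting and, in addition: (C3) the homogeneous system x' = A(t)x admits an exponential dichotomy, i.e. there are a fundamental operator solution X(t) (invertible for each t, X'(t) = A(t)X(t)), a projection P (P ∘ P = P) and constants K ≥ 1, σ > 0 with ‖X(t) ∘ P ∘ X(s)⁻¹‖ ≤ K·exp(−σ(t−s)) for t ≥ s and ‖X(t) ∘ (Id−P) ∘ X(s)⁻¹‖ ≤ K·exp(−σ(s−t)) for t ≤ s; and (bw) with M = exp(μθ̄) and m = exp(−μθ̄) one has l·M·θ̄·[1 + M(1 + lθ̄)·exp(M·l·θ̄)] < m. Then backward continuation is unique: if y₁ and y₂ are solutions of the EPCAG y' = A(t)y + f(t, y(t), y(β(t))) on ℝ and y₁(t₀) = y₂(t₀) for some t₀ ∈ ℝ, then y₁(t) = y₂(t) for all t ∈ ℝ (in particular for all t ≤ t₀). -/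
open Set Real Filter

noncomputable section

abbrev En (n : ℕ) : Type := EuclideanSpace ℝ (Fin n)

/-- `y` is a solution on ℝ of the EPCAG `y' = A(t) y + f(t, y(t), y(β(t)))`:
continuous, with the prescribed right derivative everywhere, and differentiable
at every point which is not one of the `θ i`. -/
def IsSolution {n : ℕ} (θ : ℤ → ℝ) (β : ℝ → ℝ)
    (A : ℝ → En n →L[ℝ] En n) (f : ℝ → En n → En n → En n)
    (y : ℝ → En n) : Prop :=
  Continuous y ∧
  ∀ t : ℝ,
    HasDerivWithinAt y (A t (y t) + f t (y t) (y (β t))) (Ici t) t ∧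
    (t ∉ Set.range θ → HasDerivAt y (A t (y t) + f t (y t) (y (β t))) t)

/-- Grönwall's inequality run backwards in time, with the derivative needed only in the interior. -/
theorem norm_left_le_gronwallBound {E : Type*} [NormedAddCommGroup E] [NormedSpace ℝ E]
    {z z' : ℝ → E} {a b κ ε : ℝ} (hab : a ≤ b) (hz : Continuous z)
    (hz' : ∀ t ∈ Ioo a b, HasDerivAt z (z' t) t)
    (bound : ∀ t ∈ Ioo a b, ‖z' t‖ ≤ κ * ‖z t‖ + ε) :
    ‖z a‖ ≤ gronwallBound ‖z b‖ κ ε (b - a) := by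
  rcases hab.eq_or_lt with rfl | hlt
  · simp [gronwallBound_x0]
  have key : ∀ c ∈ Ioo a b, ‖z a‖ ≤ gronwallBound ‖z c‖ κ ε (c - a) := by
    intro c hc
    have hmem : ∀ s ∈ Ico (-c) (-a), -s ∈ Ioo a b := fun s hs =>
      ⟨by linarith [hs.2], by linarith [hs.1, hc.2]⟩
    have h := norm_le_gronwallBound_of_norm_deriv_right_le
      (f := fun s => z (-s)) (f' := fun s => -z' (-s)) (δ := ‖z c‖) (K := κ) (ε := ε)
      (a := -c) (b := -a) (hz.comp continuous_neg).continuousOn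
      (fun s hs => by
        have h1 := (hz' (-s) (hmem s hs)).scomp s (hasDerivAt_neg s)
        simpa [Function.comp_def] using h1.hasDerivWithinAt)
      (by simp) (fun s hs => by simpa using bound (-s) (hmem s hs))
      (-a) ⟨by linarith [hc.1], le_rfl⟩
    simpa [neg_add_eq_sub, sub_eq_add_neg, add_comm] using h
  have hcont : Continuous fun c => gronwallBound ‖z c‖ κ ε (c - a) := by
    by_cases hκ : κ = 0
    · simp only [hκ, gronwallBound_K0]
      fun_prop
    · simp only [gronwallBound_of_K_ne_0 hκ]
      fun_prop
  refine ge_of_tendsto (hcont.continuousWithinAt (s := Iio b) (x := b)) ?_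
  filter_upwards [Ioo_mem_nhdsLT hlt] with c hc using key c hc

theorem gronwallBound_zero_le {κ ε x : ℝ} (hκ : 0 < κ) (hε : 0 ≤ ε) :
    gronwallBound 0 κ ε x ≤ ε * x * Real.exp (κ * x) := by
  rw [gronwallBound_of_K_ne_0 hκ.ne']
  have h1 : Real.exp (κ * x) - 1 ≤ κ * x * Real.exp (κ * x) := by
    have h := mul_le_mul_of_nonneg_right (Real.add_one_le_exp (-(κ * x)))
      (Real.exp_pos (κ * x)).le
    rw [← Real.exp_add, neg_add_cancel, Real.exp_zero] at h
    linarith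
  calc 0 * Real.exp (κ * x) + ε / κ * (Real.exp (κ * x) - 1)
      ≤ ε / κ * (κ * x * Real.exp (κ * x)) := by
        rw [zero_mul, zero_add]
        exact mul_le_mul_of_nonneg_left h1 (by positivity)
    _ = ε * x * Real.exp (κ * x) := by field_simp

theorem exists_mem_Ico_of_tendsto {θ : ℤ → ℝ} (hθ : StrictMono θ)
    (htop : Tendsto θ atTop atTop) (hbot : Tendsto θ atBot atBot) (t : ℝ) :
    ∃ i : ℤ, θ i ≤ t ∧ t < θ (i + 1) := by
  obtain ⟨j, hj⟩ := (htop.eventually_gt_atTop t).exists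
  obtain ⟨i, hi, hmax⟩ := Int.exists_greatest_of_bdd (P := fun i => θ i ≤ t)
    ⟨j, fun i hi => (hθ.lt_iff_lt.1 (lt_of_le_of_lt hi hj)).le⟩
    (hbot.eventually_le_atBot t).exists
  refine ⟨i, hi, not_le.1 fun h => ?_⟩
  have := hmax _ h
  omega

theorem StrictMono.notMem_range_of_mem_Ioo {θ : ℤ → ℝ} (hθ : StrictMono θ) {i : ℤ} {t : ℝ}
    (h₁ : θ i < t) (h₂ : t < θ (i + 1)) : t ∉ Set.range θ := by
  rintro ⟨j, rfl⟩
  have := hθ.lt_iff_lt.1 h₁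
  have := hθ.lt_iff_lt.1 h₂
  omega

/-- The consequence of (bw) which is needed: one backward step is a strict contraction. -/
theorem mul_exp_lt_one_of_bw {μ θb l : ℝ} (hμ : 0 ≤ μ) (hθb : 0 < θb) (hl : 0 < l)
    (hbw : l * Real.exp (μ * θb) * θb *
        (1 + Real.exp (μ * θb) * (1 + l * θb) * Real.exp (Real.exp (μ * θb) * l * θb)) <
      Real.exp (-(μ * θb))) :
    l * θb * Real.exp ((μ + l) * θb) < 1 := by
  have hM : 1 ≤ Real.exp (μ * θb) := Real.one_le_exp (by positivity)
  have hm : Real.exp (-(μ * θb)) ≤ 1 := Real.exp_le_one_iff.2 (by nlinarith)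
  set M := Real.exp (μ * θb)
  have hE : Real.exp (l * θb) ≤ Real.exp (M * l * θb) := by
    apply Real.exp_le_exp.2
    have : 0 < l * θb := by positivity
    nlinarith
  have hL : 1 ≤ 1 + l * θb := by
    have : 0 < l * θb := by positivity
    linarith
  have hfac : Real.exp (l * θb) ≤ 1 + M * (1 + l * θb) * Real.exp (M * l * θb) := by
    have h1 : 1 ≤ M * (1 + l * θb) := one_le_mul_of_one_le_of_one_le hM hL
    have h2 := le_mul_of_one_le_left (Real.exp_pos (M * l * θb)).le h1
    linarith
  calc l * θb * Real.exp ((μ + l) * θb) = l * M * θb * Real.exp (l * θb) := by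
        rw [add_mul, Real.exp_add]; ring
    _ ≤ l * M * θb * (1 + M * (1 + l * θb) * Real.exp (M * l * θb)) :=
        mul_le_mul_of_nonneg_left hfac (by positivity)
    _ < 1 := hbw.trans_le hm

/-- Under an exponential dichotomy (C3) and the smallness condition (bw),
backward continuation of solutions of the EPCAG is unique. -/
theorem stmt_2 (n : ℕ) (hn : 1 ≤ n)
    (θ : ℤ → ℝ) (hθmono : StrictMono θ)
    (θb : ℝ) (hθb : 0 < θb) (hgap : ∀ i : ℤ, θ (i + 1) - θ i ≤ θb)
    (hθtop : Tendsto θ atTop atTop) (hθbot : Tendsto θ atBot atBot)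
    (β : ℝ → ℝ) (hβ : ∀ (i : ℤ) (t : ℝ), θ i ≤ t → t < θ (i + 1) → β t = θ i)
    (A : ℝ → En n →L[ℝ] En n) (hA : Continuous A)
    (μ : ℝ) (hAb : ∀ t : ℝ, ‖A t‖ ≤ μ)
    (f : ℝ → En n → En n → En n)
    (hfc : ∀ (yy ww : En n), Continuous fun t => f t yy ww)
    (hf0 : ∀ t : ℝ, f t 0 0 = 0)
    (l : ℝ) (hl : 0 < l)
    (hflip : ∀ (t : ℝ) (y₁ w₁ y₂ w₂ : En n),
      ‖f t y₁ w₁ - f t y₂ w₂‖ ≤ l * (‖y₁ - y₂‖ + ‖w₁ - w₂‖))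
    -- condition C3): exponential dichotomy of x' = A(t) x
    (X Xinv : ℝ → En n →L[ℝ] En n)
    (hXderiv : ∀ t : ℝ, HasDerivAt X ((A t).comp (X t)) t)
    (hXinv : ∀ t : ℝ, (X t).comp (Xinv t) = ContinuousLinearMap.id ℝ (En n) ∧
      (Xinv t).comp (X t) = ContinuousLinearMap.id ℝ (En n))
    (P : En n →L[ℝ] En n) (hP : P.comp P = P)
    (K σ : ℝ) (hK : 1 ≤ K) (hσ : 0 < σ)
    (hdich₁ : ∀ t s : ℝ, s ≤ t →
      ‖(X t).comp (P.comp (Xinv s))‖ ≤ K * Real.exp (-σ * (t - s)))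
    (hdich₂ : ∀ t s : ℝ, t ≤ s →
      ‖(X t).comp ((ContinuousLinearMap.id ℝ (En n) - P).comp (Xinv s))‖ ≤
        K * Real.exp (-σ * (s - t)))
    -- condition (bw)
    (hbw : l * Real.exp (μ * θb) * θb *
        (1 + Real.exp (μ * θb) * (1 + l * θb) * Real.exp (Real.exp (μ * θb) * l * θb)) <
      Real.exp (-(μ * θb)))
    (y₁ y₂ : ℝ → En n)
    (h₁ : IsSolution θ β A f y₁) (h₂ : IsSolution θ β A f y₂)
    (t₀ : ℝ) (h₀ : y₁ t₀ = y₂ t₀) :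
    ∀ t : ℝ, y₁ t = y₂ t := by
  have hμ : 0 ≤ μ := (norm_nonneg _).trans (hAb 0)
  have hκ : 0 < μ + l := by linarith
  set z : ℝ → En n := fun t => y₁ t - y₂ t with hz
  set z' : ℝ → En n := fun t => (A t (y₁ t) + f t (y₁ t) (y₁ (β t))) -
    (A t (y₂ t) + f t (y₂ t) (y₂ (β t))) with hz'
  have hzc : Continuous z := h₁.1.sub h₂.1
  have hbound : ∀ (i : ℤ) (t : ℝ), θ i ≤ t → t < θ (i + 1) →
      ‖z' t‖ ≤ (μ + l) * ‖z t‖ + l * ‖z (θ i)‖ := by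
    intro i t hi ht
    have heq : z' t = A t (z t) +
        (f t (y₁ t) (y₁ (θ i)) - f t (y₂ t) (y₂ (θ i))) := by
      simp only [hz, hz', hβ i t hi ht, map_sub]
      abel
    rw [heq]
    have h := norm_add_le_of_le ((A t).le_of_opNorm_le (hAb t) (z t))
      (hflip t (y₁ t) (y₁ (θ i)) (y₂ t) (y₂ (θ i)))
    calc _ ≤ _ := h
      _ = _ := by ring
  have forward : ∀ i : ℤ, z (θ i) = 0 → ∀ t ∈ Icc (θ i) (θ (i + 1)), z t = 0 := by
    intro i hi t ht
    have h := norm_le_gronwallBound_of_norm_deriv_right_le (f := z) (f' := z') (δ := 0)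
      (K := μ + l) (ε := 0) hzc.continuousOn
      (fun s _ => ((h₁.2 s).1.sub (h₂.2 s).1)) (by simp [hi])
      (fun s hs => by simpa [hi] using hbound i s hs.1 hs.2) t ht
    simpa [gronwallBound_ε0_δ0] using h
  have backward : ∀ (i : ℤ), ∀ t ∈ Icc (θ i) (θ (i + 1)), z t = 0 → z (θ i) = 0 := by
    intro i t ht hzt
    have h := norm_left_le_gronwallBound (z := z) (z' := z') (κ := μ + l)
      (ε := l * ‖z (θ i)‖) ht.1 hzc
      (fun s hs => by
        have hns := hθmono.notMem_range_of_mem_Ioo hs.1 (hs.2.trans_le ht.2)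
        exact ((h₁.2 s).2 hns).sub ((h₂.2 s).2 hns))
      (fun s hs => hbound i s hs.1.le (hs.2.trans_le ht.2))
    rw [hzt, norm_zero] at h
    have hlen : t - θ i ≤ θb := by linarith [ht.2, hgap i]
    have hlen₀ : 0 ≤ t - θ i := sub_nonneg.2 ht.1
    have h' : ‖z (θ i)‖ ≤ ‖z (θ i)‖ * (l * θb * Real.exp ((μ + l) * θb)) :=
      calc ‖z (θ i)‖
          ≤ l * ‖z (θ i)‖ * (t - θ i) * Real.exp ((μ + l) * (t - θ i)) :=
            h.trans (gronwallBound_zero_le hκ (by positivity))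
        _ ≤ l * ‖z (θ i)‖ * θb * Real.exp ((μ + l) * θb) := by gcongr
        _ = ‖z (θ i)‖ * (l * θb * Real.exp ((μ + l) * θb)) := by ring
    have hlt := mul_exp_lt_one_of_bw hμ hθb hl hbw
    by_contra hne
    nlinarith [norm_pos_iff.2 hne]
  obtain ⟨i₀, hi₀, hi₀'⟩ := exists_mem_Ico_of_tendsto hθmono hθtop hθbot t₀
  have hgrid : ∀ i : ℤ, z (θ i) = 0 := by
    intro i
    induction i using Int.inductionOn' (b := i₀) with
    | zero => exact backward i₀ t₀ ⟨hi₀, hi₀'.le⟩ (sub_eq_zero.2 h₀)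
    | succ k _ ih => exact forward k ih _ ⟨(hθmono (lt_add_one k)).le, le_rfl⟩
    | pred k _ ih =>
      refine backward (k - 1) (θ k) ⟨(hθmono (sub_one_lt k)).le, ?_⟩ ih
      rw [sub_add_cancel]
  intro t
  obtain ⟨i, hi, hi'⟩ := exists_mem_Ico_of_tendsto hθmono hθtop hθbot t
  exact sub_eq_zero.1 (forward i (hgrid i) t ⟨hi, hi'.le⟩)
end
end

section
/- Assume the box-diagonal EPCAG setting, let α ∈ (0,σ) and assume 2K(1+exp(σθ̄))·L < σ−α. The stable surface S⁺ is an integral set; concretely: if z = (u,v) is a solution of system (3*) on ℝ for which there exist t₀ ∈ ℝ and C > 0 with ‖z(t)‖ ≤ C·exp(−α(t−t₀)) for all t ≥ t₀, then for EVERY t* ∈ ℝ the integral equations with base point (t*, u(t*)) hold; in particular v(t*) = −∫_{t*}^{∞} V(t*,s)·g₋(s, z(s), z(β(s))) ds for every t* ∈ ℝ. -/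
open Set Real Filter MeasureTheory

noncomputable section

abbrev Ek (k : ℕ) : Type := EuclideanSpace ℝ (Fin k)

/-- `z` is a solution of the box-diagonal EPCAG system (3*) on the set `J`:
`z` is continuous on `J`, has the prescribed right derivative at every point of `J`,
and at points not of the form `θ i` it is differentiable (within `J`). -/
def SolOn {k m : ℕ} (θ : ℤ → ℝ) (β : ℝ → ℝ)
    (Bp : ℝ → Ek k →L[ℝ] Ek k) (Bm : ℝ → Ek m →L[ℝ] Ek m)
    (gp : ℝ → Ek k × Ek m → Ek k × Ek m → Ek k)
    (gm : ℝ → Ek k × Ek m → Ek k × Ek m → Ek m)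
    (z : ℝ → Ek k × Ek m) (J : Set ℝ) : Prop :=
  ContinuousOn z J ∧
  ∀ t ∈ J,
    (HasDerivWithinAt (fun s => (z s).1)
        (Bp t (z t).1 + gp t (z t) (z (β t))) (Ici t ∩ J) t ∧
      HasDerivWithinAt (fun s => (z s).2)
        (Bm t (z t).2 + gm t (z t) (z (β t))) (Ici t ∩ J) t) ∧
    (t ∉ Set.range θ →
      HasDerivWithinAt (fun s => (z s).1)
        (Bp t (z t).1 + gp t (z t) (z (β t))) J t ∧
      HasDerivWithinAt (fun s => (z s).2)
        (Bm t (z t).2 + gm t (z t) (z (β t))) J t)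

section Transition

variable {E : Type*} [NormedAddCommGroup E] [NormedSpace ℝ E]
  {A : ℝ → E →L[ℝ] E} {Φ : ℝ → ℝ → E →L[ℝ] E}

/-- The cocycle identity for the transition operators of a linear equation. -/
lemma transition_mul (hA : Continuous A) (hid : ∀ s, Φ s s = ContinuousLinearMap.id ℝ E)
    (hderiv : ∀ s t, HasDerivAt (fun r => Φ r s) ((A t).comp (Φ t s)) t) (t s r : ℝ) :
    Φ t s * Φ s r = Φ t r := by
  obtain ⟨a, b, hs, ht⟩ : ∃ a b, s ∈ Ioo a b ∧ t ∈ Ioo a b :=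
    ⟨min s t - 1, max s t + 1, by grind, by grind⟩
  obtain ⟨M, hM⟩ := isCompact_Icc.exists_bound_of_continuousOn (s := Icc a b) hA.continuousOn
  have hlip : ∀ x ∈ Ioo a b,
      LipschitzOnWith M.toNNReal (fun X : E →L[ℝ] E => A x * X) univ := by
    intro x hx
    refine LipschitzOnWith.of_dist_le_mul fun X _ Y _ => ?_
    rw [dist_eq_norm, dist_eq_norm, ← mul_sub]
    refine (norm_mul_le _ _).trans (mul_le_mul_of_nonneg_right ?_ (norm_nonneg _))
    exact (hM x (Ioo_subset_Icc_self hx)).trans (Real.le_coe_toNNReal M)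
  refine ODE_solution_unique_of_mem_Ioo (v := fun x X => A x * X) (s := fun _ => univ)
    (f := fun x => Φ x s * Φ s r) (g := fun x => Φ x r) hlip hs
    (fun x _ => ⟨?_, mem_univ _⟩) (fun x _ => ⟨hderiv r x, mem_univ _⟩) ?_ ht
  · have h := (hderiv s x).mul_const (Φ s r)
    rwa [← ContinuousLinearMap.mul_def, mul_assoc] at h
  · rw [hid]
    rfl

variable [CompleteSpace E]

/-- The transition operators solve the adjoint equation in their second variable. -/
lemma transition_hasDerivAt_right (hA : Continuous A)
    (hid : ∀ s, Φ s s = ContinuousLinearMap.id ℝ E)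
    (hderiv : ∀ s t, HasDerivAt (fun r => Φ r s) ((A t).comp (Φ t s)) t) (t s : ℝ) :
    HasDerivAt (fun r => Φ t r) (-(Φ t s * A s)) s := by
  have hinv : ∀ a b, Φ a b * Φ b a = 1 := fun a b => by
    rw [transition_mul hA hid hderiv, hid]; rfl
  let u : ℝ → (E →L[ℝ] E)ˣ := fun r => ⟨Φ r t, Φ t r, hinv r t, hinv t r⟩
  have h := (hasFDerivAt_ringInverse (𝕜 := ℝ) (u s)).comp_hasDerivAt s (hderiv t s)
  have hfun : (Ring.inverse ∘ fun r => Φ r t) = fun r => Φ t r :=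
    funext fun r => Ring.inverse_unit (u r)
  rw [hfun] at h
  refine h.congr_deriv ?_
  change -(Φ t s * (A s * Φ s t) * Φ t s) = -(Φ t s * A s)
  rw [mul_assoc, mul_assoc, hinv, mul_one]

/-- Variation of constants for a right-differentiable solution. -/
lemma variation_of_constants (hA : Continuous A)
    (hid : ∀ s, Φ s s = ContinuousLinearMap.id ℝ E)
    (hderiv : ∀ s t, HasDerivAt (fun r => Φ r s) ((A t).comp (Φ t s)) t)
    {x f : ℝ → E} (hx : Continuous x)
    (hx' : ∀ t, HasDerivWithinAt x (A t (x t) + f t) (Ici t) t) {s t : ℝ}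
    (hint : IntervalIntegrable (fun r => Φ t r (f r)) volume s t) :
    x t = Φ t s (x s) + ∫ r in s..t, Φ t r (f r) := by
  have hΦ := transition_hasDerivAt_right hA hid hderiv t
  have hcont : Continuous fun r => Φ t r :=
    continuous_iff_continuousAt.2 fun r => (hΦ r).continuousAt
  rw [intervalIntegral.integral_eq_sub_of_hasDeriv_right (f := fun r => Φ t r (x r))
    (hcont.clm_apply hx).continuousOn (fun r _ => ?_) hint, hid]
  · simp
  · have h := (hΦ r).hasDerivWithinAt.clm_apply ((hx' r).mono Ioi_subset_Ici_self)
    convert h using 1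
    simp

end Transition

section PiecewiseConstantArgument

variable {θ : ℤ → ℝ} {β : ℝ → ℝ}

lemma exists_mem_grid_interval (hθtop : Tendsto θ atTop atTop) (hθbot : Tendsto θ atBot atBot)
    (hθmono : StrictMono θ) (t : ℝ) : ∃ i, θ i ≤ t ∧ t < θ (i + 1) := by
  obtain ⟨b, hb⟩ := (hθtop.eventually_gt_atTop t).exists
  obtain ⟨i, hi, hmax⟩ := Int.exists_greatest_of_bdd (P := fun i => θ i ≤ t)
    ⟨b, fun j hj => (hθmono.lt_iff_lt.1 (hj.trans_lt hb)).le⟩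
    (hθbot.eventually_le_atBot t).exists
  refine ⟨i, hi, not_le.1 fun h => ?_⟩
  have := hmax _ h
  lia

lemma gridFloor_mem_Icc (hθtop : Tendsto θ atTop atTop) (hθbot : Tendsto θ atBot atBot)
    (hθmono : StrictMono θ) {θb : ℝ} (hgap : ∀ i, θ (i + 1) - θ i ≤ θb)
    (hβ : ∀ i t, θ i ≤ t → t < θ (i + 1) → β t = θ i) (t : ℝ) : β t ∈ Icc (t - θb) t := by
  obtain ⟨i, hi, hi'⟩ := exists_mem_grid_interval hθtop hθbot hθmono t
  rw [hβ i t hi hi']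
  exact ⟨by linarith [hgap i], hi⟩

lemma gridFloor_monotone (hθtop : Tendsto θ atTop atTop) (hθbot : Tendsto θ atBot atBot)
    (hθmono : StrictMono θ) (hβ : ∀ i t, θ i ≤ t → t < θ (i + 1) → β t = θ i) :
    Monotone β := by
  intro s t hst
  obtain ⟨i, hi, hi'⟩ := exists_mem_grid_interval hθtop hθbot hθmono s
  obtain ⟨j, hj, hj'⟩ := exists_mem_grid_interval hθtop hθbot hθmono t
  rw [hβ i s hi hi', hβ j t hj hj']
  have : i < j + 1 := hθmono.lt_iff_lt.1 (hi.trans_lt (hst.trans_lt hj'))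
  exact hθmono.monotone (by lia)

end PiecewiseConstantArgument

section Forcing

variable {P E : Type*} [NormedAddCommGroup P] [NormedAddCommGroup E]
  {F : ℝ → P → P → E} {L : ℝ} {z : ℝ → P} {β : ℝ → ℝ}

lemma continuous_of_lipschitz_pair (hc : ∀ p q, Continuous fun t => F t p q) (hL : 0 ≤ L)
    (hlip : ∀ t p q p' q', ‖F t p q - F t p' q'‖ ≤ L * (‖p - p'‖ + ‖q - q'‖)) :
    Continuous fun x : ℝ × P × P => F x.1 x.2.1 x.2.2 := by
  refine continuous_prod_of_continuous_lipschitzWith' _ (2 * L).toNNReal (fun t => ?_)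
    (fun p => hc p.1 p.2)
  refine LipschitzWith.of_dist_le_mul fun p q => ?_
  rw [Real.coe_toNNReal _ (by positivity), dist_eq_norm, dist_eq_norm]
  have h1 : ‖p.1 - q.1‖ ≤ ‖p - q‖ := norm_fst_le (p - q)
  have h2 : ‖p.2 - q.2‖ ≤ ‖p - q‖ := norm_snd_le (p - q)
  calc _ ≤ L * (‖p.1 - q.1‖ + ‖p.2 - q.2‖) := hlip ..
    _ ≤ L * (‖p - q‖ + ‖p - q‖) := by gcongr
    _ = _ := by ring

variable [NormedSpace ℝ E]

lemma stronglyMeasurable_clm_forcing {Ψ : ℝ → E →L[ℝ] E} (hΨ : Continuous Ψ)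
    (hF : Continuous fun x : ℝ × P × P => F x.1 x.2.1 x.2.2)
    (hz : Continuous z) (hβ : Measurable β) :
    StronglyMeasurable fun s => Ψ s (F s (z s) (z (β s))) :=
  (isBoundedBilinearMap_apply (𝕜 := ℝ) (E := E) (F := E)).continuous.comp_stronglyMeasurable
    (hΨ.stronglyMeasurable.prodMk (hF.comp_stronglyMeasurable
      (stronglyMeasurable_id.prodMk
        (hz.stronglyMeasurable.prodMk (hz.stronglyMeasurable.comp_measurable hβ)))))

lemma intervalIntegrable_clm_forcing {Ψ : ℝ → E →L[ℝ] E} (hΨ : Continuous Ψ)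
    (hF : Continuous fun x : ℝ × P × P => F x.1 x.2.1 x.2.2)
    (hz : Continuous z) (hβ : Measurable β) {τ : ℝ} (hβτ : ∀ t, β t ∈ Icc (t - τ) t)
    (hL : 0 ≤ L) (hbound : ∀ t p q, ‖F t p q‖ ≤ L * (‖p‖ + ‖q‖)) (a b : ℝ) :
    IntervalIntegrable (fun s => Ψ s (F s (z s) (z (β s)))) volume a b := by
  have hτ : 0 ≤ τ := by linarith [(hβτ 0).1, (hβτ 0).2]
  obtain ⟨M, hM⟩ := isCompact_Icc.exists_bound_of_continuousOn
    (s := Icc (min a b - τ) (max a b)) hz.continuousOn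
  obtain ⟨N, hN⟩ := isCompact_uIcc.exists_bound_of_continuousOn (s := uIcc a b) hΨ.continuousOn
  rw [intervalIntegrable_iff]
  refine Measure.integrableOn_of_bounded (M := N * (L * (M + M))) (by simp)
    (stronglyMeasurable_clm_forcing hΨ hF hz hβ).aestronglyMeasurable
    ((ae_restrict_iff' measurableSet_uIoc).2 (Eventually.of_forall fun s hs => ?_))
  have hs' : s ∈ Icc (min a b) (max a b) := uIoc_subset_uIcc hs
  have h1 := hM s ⟨by linarith [hs'.1], hs'.2⟩
  have h2 := hM (β s) ⟨by linarith [hs'.1, (hβτ s).1], (hβτ s).2.trans hs'.2⟩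
  have h3 := hN s hs'
  refine (ContinuousLinearMap.le_opNorm _ _).trans ?_
  gcongr
  · exact (norm_nonneg _).trans h3
  · exact (hbound _ _ _).trans (by gcongr)

lemma integrableOn_Ioi_clm_forcing {Ψ : ℝ → E →L[ℝ] E} (hΨ : Continuous Ψ)
    (hF : Continuous fun x : ℝ × P × P => F x.1 x.2.1 x.2.2)
    (hz : Continuous z) (hβ : Measurable β) {τ : ℝ} (hβτ : ∀ t, β t ∈ Icc (t - τ) t)
    (hL : 0 ≤ L) (hbound : ∀ t p q, ‖F t p q‖ ≤ L * (‖p‖ + ‖q‖)) {t K σ M : ℝ} (hσ : 0 < σ)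
    (hΨb : ∀ s, t ≤ s → ‖Ψ s‖ ≤ K * Real.exp (-σ * (s - t)))
    (hM : ∀ s, t - τ ≤ s → ‖z s‖ ≤ M) :
    IntegrableOn (fun s => Ψ s (F s (z s) (z (β s)))) (Ioi t) := by
  have hτ : 0 ≤ τ := by linarith [(hβτ 0).1, (hβτ 0).2]
  have hexp := (exp_neg_integrableOn_Ioi t hσ).const_mul (K * Real.exp (σ * t) * (L * (M + M)))
  refine hexp.mono' (stronglyMeasurable_clm_forcing hΨ hF hz hβ).aestronglyMeasurable
    ((ae_restrict_iff' measurableSet_Ioi).2 (Eventually.of_forall fun s hs => ?_))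
  have hs : t < s := hs
  have h1 := hM s (by linarith)
  have h2 := hM (β s) (by linarith [(hβτ s).1])
  have h3 := hΨb s hs.le
  calc ‖Ψ s (F s (z s) (z (β s)))‖ ≤ ‖Ψ s‖ * ‖F s (z s) (z (β s))‖ := (Ψ s).le_opNorm _
    _ ≤ (K * Real.exp (-σ * (s - t))) * (L * (M + M)) := by
        gcongr
        · exact (norm_nonneg _).trans h3
        · exact (hbound _ _ _).trans (by gcongr)
    _ = _ := by
        rw [show -σ * (s - t) = σ * t + -σ * s by ring, Real.exp_add]
        ring

end Forcing

lemma exists_bound_Ici_of_decay {P : Type*} [NormedAddCommGroup P] {z : ℝ → P}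
    (hz : Continuous z) {α C t₀ : ℝ} (hα : 0 ≤ α) (hC : 0 ≤ C)
    (hdecay : ∀ t, t₀ ≤ t → ‖z t‖ ≤ C * Real.exp (-α * (t - t₀))) (a : ℝ) :
    ∃ M, ∀ s, a ≤ s → ‖z s‖ ≤ M := by
  obtain ⟨M, hM⟩ := isCompact_Icc.exists_bound_of_continuousOn (s := Icc a t₀) hz.continuousOn
  refine ⟨max M C, fun s hs => ?_⟩
  rcases le_total s t₀ with h | h
  · exact (hM s ⟨hs, h⟩).trans (le_max_left _ _)
  · refine (hdecay s h).trans (le_trans ?_ (le_max_right _ _))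
    refine mul_le_of_le_one_right hC (Real.exp_le_one_iff.2 ?_)
    nlinarith [mul_nonneg hα (sub_nonneg.2 h)]

theorem stmt_6
    (k m : ℕ) (hk : 1 ≤ k) (hm : 1 ≤ m)
    (θ : ℤ → ℝ) (hθmono : StrictMono θ)
    (θb : ℝ) (hθb : 0 < θb) (hgap : ∀ i : ℤ, θ (i + 1) - θ i ≤ θb)
    (hθtop : Tendsto θ atTop atTop) (hθbot : Tendsto θ atBot atBot)
    (β : ℝ → ℝ) (hβ : ∀ (i : ℤ) (t : ℝ), θ i ≤ t → t < θ (i + 1) → β t = θ i)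
    (Bp : ℝ → Ek k →L[ℝ] Ek k) (Bm : ℝ → Ek m →L[ℝ] Ek m)
    (hBp : Continuous Bp) (hBm : Continuous Bm)
    (U : ℝ → ℝ → Ek k →L[ℝ] Ek k) (V : ℝ → ℝ → Ek m →L[ℝ] Ek m)
    (hUid : ∀ s : ℝ, U s s = ContinuousLinearMap.id ℝ (Ek k))
    (hVid : ∀ s : ℝ, V s s = ContinuousLinearMap.id ℝ (Ek m))
    (hUderiv : ∀ s t : ℝ, HasDerivAt (fun r => U r s) ((Bp t).comp (U t s)) t)
    (hVderiv : ∀ s t : ℝ, HasDerivAt (fun r => V r s) ((Bm t).comp (V t s)) t)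
    (K σ : ℝ) (hK : 1 ≤ K) (hσ : 0 < σ)
    (hU : ∀ s t : ℝ, s ≤ t → ‖U t s‖ ≤ K * Real.exp (-σ * (t - s)))
    (hV : ∀ s t : ℝ, t ≤ s → ‖V t s‖ ≤ K * Real.exp (-σ * (s - t)))
    (gp : ℝ → Ek k × Ek m → Ek k × Ek m → Ek k)
    (gm : ℝ → Ek k × Ek m → Ek k × Ek m → Ek m)
    (hgpc : ∀ zz ww, Continuous fun t => gp t zz ww)
    (hgmc : ∀ zz ww, Continuous fun t => gm t zz ww)
    (L : ℝ) (hL : 0 < L)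
    (hlip : ∀ (t : ℝ) (z₁ w₁ z₂ w₂ : Ek k × Ek m),
      ‖gp t z₁ w₁ - gp t z₂ w₂‖ + ‖gm t z₁ w₁ - gm t z₂ w₂‖ ≤
        L * (‖z₁ - z₂‖ + ‖w₁ - w₂‖))
    (hg0 : ∀ t : ℝ, gp t 0 0 = 0 ∧ gm t 0 0 = 0)
    (α : ℝ) (hα : 0 < α) (hασ : α < σ)
    (hsmall : 2 * K * (1 + Real.exp (σ * θb)) * L < σ - α)
    (z : ℝ → Ek k × Ek m) (hz : SolOn θ β Bp Bm gp gm z Set.univ)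
    (t₀ C : ℝ) (hC : 0 < C)
    (hdecay : ∀ t : ℝ, t₀ ≤ t → ‖z t‖ ≤ C * Real.exp (-α * (t - t₀))) :
    ∀ tstar t : ℝ,
      ((z t).1 = U t tstar (z tstar).1 + ∫ s in tstar..t, U t s (gp s (z s) (z (β s)))) ∧
      IntegrableOn (fun s => V t s (gm s (z s) (z (β s)))) (Ioi t) ∧
      (z t).2 = -∫ s in Ioi t, V t s (gm s (z s) (z (β s))) := by
  have hzc : Continuous z := continuousOn_univ.1 hz.1
  have hβI := gridFloor_mem_Icc hθtop hθbot hθmono hgap hβ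
  have hβm := (gridFloor_monotone hθtop hθbot hθmono hβ).measurable
  have hlipp : ∀ t p q p' q', ‖gp t p q - gp t p' q'‖ ≤ L * (‖p - p'‖ + ‖q - q'‖) :=
    fun t p q p' q' => le_of_add_le_of_nonneg_left (hlip t p q p' q') (norm_nonneg _)
  have hlipm : ∀ t p q p' q', ‖gm t p q - gm t p' q'‖ ≤ L * (‖p - p'‖ + ‖q - q'‖) :=
    fun t p q p' q' => le_of_add_le_of_nonneg_right (hlip t p q p' q') (norm_nonneg _)
  have hboundp : ∀ t p q, ‖gp t p q‖ ≤ L * (‖p‖ + ‖q‖) := fun t p q => by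
    simpa [(hg0 t).1] using hlipp t p q 0 0
  have hboundm : ∀ t p q, ‖gm t p q‖ ≤ L * (‖p‖ + ‖q‖) := fun t p q => by
    simpa [(hg0 t).2] using hlipm t p q 0 0
  have hgp := continuous_of_lipschitz_pair hgpc hL.le hlipp
  have hgm := continuous_of_lipschitz_pair hgmc hL.le hlipm
  have hUc : ∀ t, Continuous (U t) := fun t => continuous_iff_continuousAt.2 fun s =>
    (transition_hasDerivAt_right hBp hUid hUderiv t s).continuousAt
  have hVc : ∀ t, Continuous (V t) := fun t => continuous_iff_continuousAt.2 fun s =>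
    (transition_hasDerivAt_right hBm hVid hVderiv t s).continuousAt
  have hu' := fun t => (hz.2 t (mem_univ t)).1.1
  have hv' := fun t => (hz.2 t (mem_univ t)).1.2
  simp only [inter_univ] at hu' hv'
  intro tstar t
  obtain ⟨M, hM⟩ := exists_bound_Ici_of_decay hzc hα.le hC.le hdecay (t - θb)
  have hVint := integrableOn_Ioi_clm_forcing (hVc t) hgm hzc hβm hβI hL.le hboundm hσ
    (fun s hs => hV s t hs) hM
  refine ⟨?_, hVint, ?_⟩
  · exact variation_of_constants hBp hUid hUderiv hzc.fst hu'
      (intervalIntegrable_clm_forcing (hUc t) hgp hzc hβm hβI hL.le hboundp _ _)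
  have hvoc : ∀ s, V t s (z s).2 =
      (z t).2 + ∫ r in t..s, V t r (gm r (z r) (z (β r))) := fun s => by
    rw [intervalIntegral.integral_symm, ← sub_eq_add_neg, eq_sub_iff_add_eq]
    exact (variation_of_constants hBm hVid hVderiv hzc.snd hv'
      (intervalIntegrable_clm_forcing (hVc t) hgm hzc hβm hβI hL.le hboundm _ _)).symm
  have hlim : Tendsto (fun s => V t s (z s).2) atTop
      (nhds ((z t).2 + ∫ r in Ioi t, V t r (gm r (z r) (z (β r))))) := by
    simp_rw [hvoc]
    exact (intervalIntegral_tendsto_integral_Ioi t hVint tendsto_id).const_add _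
  have hexp : Tendsto (fun s => K * Real.exp (-σ * (s - t)) * M) atTop (nhds 0) := by
    have h : Tendsto (fun s : ℝ => -σ * (s - t)) atTop atBot :=
      (tendsto_atTop_add_const_right _ (-t) tendsto_id).const_mul_atTop_of_neg (neg_lt_zero.2 hσ)
    simpa using ((Real.tendsto_exp_atBot.comp h).const_mul K).mul_const M
  have hzero : Tendsto (fun s => V t s (z s).2) atTop (nhds 0) := by
    refine squeeze_zero_norm' ?_ hexp
    filter_upwards [eventually_ge_atTop t] with s hs
    refine ((V t s).le_opNorm _).trans ?_
    gcongr
    · exact hV s t hs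
    · exact (norm_snd_le _).trans (hM s (by linarith))
  exact eq_neg_of_add_eq_zero_left (tendsto_nhds_unique hlim hzero)
end
end

section
/- Assume the box-diagonal EPCAG setting, except that instead of g₊(t,0,0) = 0 = g₋(t,0,0) assume only ‖g₊(t,0,0)‖ ≤ H and ‖g₋(t,0,0)‖ ≤ H for all t ∈ ℝ, for a constant H > 0; assume condition (bw) and 2KL/σ < 1. Assume moreover the periodicity conditions: there is ω > 0 with B₊(t+ω) = B₊(t), B₋(t+ω) = B₋(t), g₊(t+ω,z,w) = g₊(t,z,w) and g₋(t+ω,z,w) = g₋(t,z,w) for all t, z, w; there are ω̄ > 0 and a positive integer p with θ_{i+p} = θ_i + ω̄ for all i ∈ ℤ; and ω/ω̄ = k₀/m₀ for some positive integers k₀, m₀. Then system (3*) admits an m₀ω-periodic solution on ℝ, i.e. a solution z with z(t + m₀ω) = z(t) for all t ∈ ℝ. -/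
open Set Real Filter MeasureTheory

noncomputable section

open scoped Topology NNReal BoundedContinuousFunction

section TransitionOperator

variable {E : Type*} [NormedAddCommGroup E] [NormedSpace ℝ E]

/-- `U` is the transition operator of the linear equation `u' = B(t) u`. -/
structure IsTransition (B : ℝ → E →L[ℝ] E) (U : ℝ → ℝ → E →L[ℝ] E) : Prop where
  self (s : ℝ) : U s s = ContinuousLinearMap.id ℝ E
  hasDerivAt (s t : ℝ) : HasDerivAt (fun r => U r s) ((B t).comp (U t s)) t

namespace IsTransition

variable {B : ℝ → E →L[ℝ] E} {U : ℝ → ℝ → E →L[ℝ] E}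

theorem eq_of_hasDerivAt {M : ℝ} (hB : ∀ t, ‖B t‖ ≤ M) {X Y : ℝ → E →L[ℝ] E}
    (hX : ∀ t, HasDerivAt X ((B t).comp (X t)) t) (hY : ∀ t, HasDerivAt Y ((B t).comp (Y t)) t)
    {t₀ : ℝ} (h : X t₀ = Y t₀) : X = Y := by
  have hM : 0 ≤ M := (norm_nonneg _).trans (hB 0)
  refine ODE_solution_unique_univ (v := fun t A => (B t).comp A) (s := fun _ => univ)
    (K := ⟨M, hM⟩) (fun t => ?_) (fun t => ⟨hX t, mem_univ _⟩) (fun t => ⟨hY t, mem_univ _⟩) h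
  refine (LipschitzWith.of_dist_le_mul fun A A' => ?_).lipschitzOnWith
  rw [dist_eq_norm, dist_eq_norm, ← ContinuousLinearMap.comp_sub]
  exact (ContinuousLinearMap.opNorm_comp_le _ _).trans
    (mul_le_mul_of_nonneg_right (hB t) (norm_nonneg _))

theorem comp_eq (hU : IsTransition B U) {M : ℝ} (hB : ∀ t, ‖B t‖ ≤ M) (t r s : ℝ) :
    (U t r).comp (U r s) = U t s := by
  refine congrFun (eq_of_hasDerivAt hB (X := fun t => (U t r).comp (U r s)) (Y := fun t => U t s)
    (fun t => ?_) (fun t => hU.hasDerivAt s t) (t₀ := r) ?_) t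
  · have := (hU.hasDerivAt r t).clm_comp (hasDerivAt_const t (U r s))
    simpa [ContinuousLinearMap.comp_assoc] using this
  · simp [hU.self]

theorem apply_apply (hU : IsTransition B U) {M : ℝ} (hB : ∀ t, ‖B t‖ ≤ M) (t r s : ℝ) (x : E) :
    U t r (U r s x) = U t s x := by
  rw [← hU.comp_eq hB t r s]; rfl

theorem add_add_eq (hU : IsTransition B U) {M : ℝ} (hB : ∀ t, ‖B t‖ ≤ M) {T : ℝ}
    (hT : Function.Periodic B T) (t s : ℝ) : U (t + T) (s + T) = U t s := by
  refine congrFun (eq_of_hasDerivAt hB (X := fun t => U (t + T) (s + T)) (Y := fun t => U t s)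
    (fun t => ?_) (fun t => hU.hasDerivAt s t) (t₀ := s) ?_) t
  · have := (hU.hasDerivAt (s + T) (t + T)).comp_add_const t T
    rwa [hT t] at this
  · simp [hU.self]

theorem continuous_left (hU : IsTransition B U) (s : ℝ) : Continuous fun t => U t s :=
  continuous_iff_continuousAt.2 fun t => (hU.hasDerivAt s t).continuousAt

theorem continuous_right [CompleteSpace E] (hU : IsTransition B U) {M : ℝ}
    (hB : ∀ t, ‖B t‖ ≤ M) (t : ℝ) : Continuous fun s => U t s := by
  let u (s : ℝ) : (E →L[ℝ] E)ˣ :=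
    ⟨U s t, U t s, (hU.comp_eq hB s t s).trans (hU.self s), (hU.comp_eq hB t s t).trans (hU.self t)⟩
  have h (s : ℝ) : U t s = Ring.inverse (U s t) := (Ring.inverse_unit (u s)).symm
  simp only [h]
  exact continuous_iff_continuousAt.2 fun s =>
    ContinuousAt.comp (f := fun s => U s t) (NormedRing.inverse_continuousAt (u s))
      (hU.continuous_left t).continuousAt

theorem stronglyMeasurable_apply [CompleteSpace E] (hU : IsTransition B U) {M : ℝ}
    (hB : ∀ t, ‖B t‖ ≤ M) {f : ℝ → E} (hf : StronglyMeasurable f) (t : ℝ) :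
    StronglyMeasurable fun s => U t s (f s) :=
  isBoundedBilinearMap_apply.continuous.comp_stronglyMeasurable
    ((hU.continuous_right hB t).stronglyMeasurable.prodMk hf)

theorem intervalIntegrable_apply [CompleteSpace E] (hU : IsTransition B U) {M : ℝ}
    (hB : ∀ t, ‖B t‖ ≤ M) {f : ℝ → E} (hf : StronglyMeasurable f) {C : ℝ} (hC : ∀ s, ‖f s‖ ≤ C)
    (t a b : ℝ) : IntervalIntegrable (fun s => U t s (f s)) volume a b := by
  refine IntervalIntegrable.mono_fun
    (((hU.continuous_right hB t).norm.mul continuous_const).intervalIntegrable (μ := volume) a b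
      : IntervalIntegrable (fun s => ‖U t s‖ * C) volume a b)
    (hU.stronglyMeasurable_apply hB hf t).aestronglyMeasurable (ae_of_all _ fun s => ?_)
  have hC0 : 0 ≤ C := (norm_nonneg _).trans (hC 0)
  change ‖U t s (f s)‖ ≤ ‖‖U t s‖ * C‖
  rw [norm_mul, norm_norm, Real.norm_of_nonneg hC0]
  exact (U t s).le_opNorm_of_le (hC s)

/-- Variation of constants. -/
theorem hasDerivWithinAt_variation [CompleteSpace E] (hU : IsTransition B U) {M : ℝ}
    (hB : ∀ t, ‖B t‖ ≤ M) {f : ℝ → E} (hf : StronglyMeasurable f) {C : ℝ} (hC : ∀ s, ‖f s‖ ≤ C)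
    (c : E) {t : ℝ} {S S' : Set ℝ}
    [intervalIntegral.FTCFilter t (𝓝[S] t) (𝓝[S'] t)] (hft : ContinuousWithinAt f S' t) :
    HasDerivWithinAt (fun t => U t 0 (c + ∫ s in (0 : ℝ)..t, U 0 s (f s)))
      (B t (U t 0 (c + ∫ s in (0 : ℝ)..t, U 0 s (f s))) + f t) S t := by
  have hint : HasDerivWithinAt (fun t => ∫ s in (0 : ℝ)..t, U 0 s (f s)) (U 0 t (f t)) S t :=
    intervalIntegral.integral_hasDerivWithinAt_right (t := S')
      (hU.intervalIntegrable_apply hB hf hC 0 0 t)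
      (hU.stronglyMeasurable_apply hB hf 0).stronglyMeasurableAtFilter
      ((hU.continuous_right hB 0).continuousWithinAt.clm_apply hft)
  have h := (hU.hasDerivAt 0 t).hasDerivWithinAt (s := S) |>.clm_apply (hint.const_add c)
  rwa [hU.apply_apply hB, hU.self] at h

theorem continuous_variation [CompleteSpace E] (hU : IsTransition B U) {M : ℝ}
    (hB : ∀ t, ‖B t‖ ≤ M) {f : ℝ → E} (hf : StronglyMeasurable f) {C : ℝ} (hC : ∀ s, ‖f s‖ ≤ C)
    (c : E) : Continuous fun t => U t 0 (c + ∫ s in (0 : ℝ)..t, U 0 s (f s)) :=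
  (hU.continuous_left 0).clm_apply (continuous_const.add
    (intervalIntegral.continuous_primitive (hU.intervalIntegrable_apply hB hf hC 0) 0))

end IsTransition

end TransitionOperator

section Response

variable {E : Type*} [NormedAddCommGroup E] [NormedSpace ℝ E]

/-- The response `∫_{S t} U(t,s) f(s) ds` to a forcing term `f`. -/
def response (U : ℝ → ℝ → E →L[ℝ] E) (S : ℝ → Set ℝ) (f : ℝ → E) (t : ℝ) : E :=
  ∫ s in S t, U t s (f s)

/-- The kernel `U(t,·)` has an integrable majorant of mass `κ` on `S t`, for every `t`. -/
def HasKernelBound (U : ℝ → ℝ → E →L[ℝ] E) (S : ℝ → Set ℝ) (κ : ℝ) : Prop :=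
  ∀ t, MeasurableSet (S t) ∧ ∃ φ : ℝ → ℝ, IntegrableOn φ (S t) ∧ (∀ s ∈ S t, ‖U t s‖ ≤ φ s) ∧
    ∫ s in S t, φ s = κ

theorem hasKernelBound_Iic {U : ℝ → ℝ → E →L[ℝ] E} {K σ : ℝ} (hσ : 0 < σ)
    (hU : ∀ s t : ℝ, s ≤ t → ‖U t s‖ ≤ K * Real.exp (-σ * (t - s))) :
    HasKernelBound U Iic (K / σ) := by
  intro t
  refine ⟨measurableSet_Iic, fun s => K * Real.exp (-σ * t) * Real.exp (σ * s),
    (integrableOn_exp_mul_Iic hσ t).const_mul _, fun s hs => (hU s t hs).trans_eq ?_, ?_⟩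
  · simp only [mul_assoc, ← Real.exp_add]; ring_nf
  · rw [integral_const_mul, integral_exp_mul_Iic hσ, mul_div_assoc', mul_assoc, ← Real.exp_add]
    simp

theorem hasKernelBound_Ioi {V : ℝ → ℝ → E →L[ℝ] E} {K σ : ℝ} (hσ : 0 < σ)
    (hV : ∀ s t : ℝ, t ≤ s → ‖V t s‖ ≤ K * Real.exp (-σ * (s - t))) :
    HasKernelBound V Ioi (K / σ) := by
  intro t
  refine ⟨measurableSet_Ioi, fun s => K * Real.exp (σ * t) * Real.exp (-σ * s),
    (integrableOn_exp_mul_Ioi (neg_lt_zero.2 hσ) t).const_mul _,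
    fun s hs => (hV s t (le_of_lt hs)).trans_eq ?_, ?_⟩
  · simp only [mul_assoc, ← Real.exp_add]; ring_nf
  · rw [integral_const_mul, integral_exp_mul_Ioi (neg_lt_zero.2 hσ), neg_div_neg_eq,
      mul_div_assoc', mul_assoc, ← Real.exp_add]
    simp

variable {U : ℝ → ℝ → E →L[ℝ] E} {S : ℝ → Set ℝ} {κ C : ℝ} {f g : ℝ → E}

theorem HasKernelBound.norm_response_le (hS : HasKernelBound U S κ) (hC : ∀ s, ‖f s‖ ≤ C)
    (t : ℝ) : ‖response U S f t‖ ≤ κ * C := by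
  obtain ⟨hm, φ, hφ, hle, hκ⟩ := hS t
  refine (norm_integral_le_of_norm_le (hφ.mul_const C) ?_).trans_eq
    ((integral_mul_const C φ).trans (by rw [hκ]))
  filter_upwards [ae_restrict_mem hm] with s hs
  exact (U t s).le_of_opNorm_le_of_le (hle s hs) (hC s)

theorem response_add {T : ℝ} (hUT : ∀ t s, U (t + T) (s + T) = U t s)
    (hST : ∀ t, (fun s => s + T) ⁻¹' S (t + T) = S t) (f : ℝ → E) (t : ℝ) :
    response U S f (t + T) = response U S (fun s => f (s + T)) t := by
  have h := (measurePreserving_add_right volume T).setIntegral_preimage_emb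
    (MeasurableEquiv.addRight T).measurableEmbedding (fun s => U (t + T) s (f s)) (S (t + T))
  rw [response, ← h, hST]
  simp only [hUT, response]

variable [CompleteSpace E] {B : ℝ → E →L[ℝ] E} {M : ℝ}

theorem HasKernelBound.integrableOn (hS : HasKernelBound U S κ) (hU : IsTransition B U)
    (hB : ∀ t, ‖B t‖ ≤ M) (hf : StronglyMeasurable f) (hC : ∀ s, ‖f s‖ ≤ C) (r t : ℝ) :
    IntegrableOn (fun s => U r s (f s)) (S t) := by
  obtain ⟨hm, φ, hφ, hle, -⟩ := hS t
  have h : IntegrableOn (fun s => U t s (f s)) (S t) := by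
    refine Integrable.mono' (hφ.mul_const C)
      (hU.stronglyMeasurable_apply hB hf t).aestronglyMeasurable ?_
    filter_upwards [ae_restrict_mem hm] with s hs
    exact (U t s).le_of_opNorm_le_of_le (hle s hs) (hC s)
  have h' := (U r t).integrable_comp h
  simp only [hU.apply_apply hB] at h'
  exact h'

theorem HasKernelBound.response_sub (hS : HasKernelBound U S κ) (hU : IsTransition B U)
    (hB : ∀ t, ‖B t‖ ≤ M) (hf : StronglyMeasurable f) (hC : ∀ s, ‖f s‖ ≤ C)
    (hg : StronglyMeasurable g) {D : ℝ} (hD : ∀ s, ‖g s‖ ≤ D) (t : ℝ) :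
    response U S f t - response U S g t = response U S (fun s => f s - g s) t := by
  simp only [response, map_sub]
  exact (integral_sub (hS.integrableOn hU hB hf hC t t) (hS.integrableOn hU hB hg hD t t)).symm

theorem response_Iic_eq (hS : HasKernelBound U Iic κ) (hU : IsTransition B U)
    (hB : ∀ t, ‖B t‖ ≤ M) (hf : StronglyMeasurable f) (hC : ∀ s, ‖f s‖ ≤ C) (t : ℝ) :
    response U Iic f t =
      U t 0 ((∫ s in Iic 0, U 0 s (f s)) + ∫ s in (0 : ℝ)..t, U 0 s (f s)) := by
  have hi := hS.integrableOn hU hB hf hC 0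
  rw [← intervalIntegral.integral_Iic_sub_Iic (hi 0) (hi t), add_sub_cancel,
    ← ContinuousLinearMap.integral_comp_comm _ (hi t)]
  simp only [hU.apply_apply hB, response]

theorem neg_response_Ioi_eq (hS : HasKernelBound U Ioi κ) (hU : IsTransition B U)
    (hB : ∀ t, ‖B t‖ ≤ M) (hf : StronglyMeasurable f) (hC : ∀ s, ‖f s‖ ≤ C) (t : ℝ) :
    -response U Ioi f t =
      U t 0 (-(∫ s in Ioi 0, U 0 s (f s)) + ∫ s in (0 : ℝ)..t, U 0 s (f s)) := by
  have hi := hS.integrableOn hU hB hf hC 0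
  rw [← intervalIntegral.integral_Ioi_sub_Ioi' (hi 0) (hi t), neg_add_eq_sub, sub_sub_cancel_left,
    map_neg, ← ContinuousLinearMap.integral_comp_comm _ (hi t)]
  simp only [hU.apply_apply hB, response]

end Response

section Source

variable {X E : Type*}

/-- The forcing term `s ↦ g(s, z(s), z(β(s)))` produced by a function `z`. -/
def source (g : ℝ → X → X → E) (β : ℝ → ℝ) (z : ℝ → X) (s : ℝ) : E :=
  g s (z s) (z (β s))

theorem source_comp_add {g : ℝ → X → X → E} {β : ℝ → ℝ} {T : ℝ}
    (hgT : ∀ t z w, g (t + T) z w = g t z w) (hβT : ∀ t, β (t + T) = β t + T) (z : ℝ → X) (s : ℝ) :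
    source g β (fun t => z (t + T)) s = source g β z (s + T) := by
  simp only [source, hgT, hβT]

variable [NormedAddCommGroup X] [NormedAddCommGroup E]

/-- `g` is continuous in time and Lipschitz in the two states, and `g(t,0,0)` is bounded. -/
structure IsAdmissible (g : ℝ → X → X → E) (L H : ℝ) : Prop where
  continuous_time (z w : X) : Continuous fun t => g t z w
  lipschitz (t : ℝ) (z₁ w₁ z₂ w₂ : X) :
    ‖g t z₁ w₁ - g t z₂ w₂‖ ≤ L * (‖z₁ - z₂‖ + ‖w₁ - w₂‖)
  bound (t : ℝ) : ‖g t 0 0‖ ≤ H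
  nonneg : 0 ≤ L

namespace IsAdmissible

variable {g : ℝ → X → X → E} {L H : ℝ} {β : ℝ → ℝ}

theorem continuous_uncurry (hg : IsAdmissible g L H) :
    Continuous fun q : ℝ × X × X => g q.1 q.2.1 q.2.2 := by
  refine continuous_prod_of_continuous_lipschitzWith' _ (⟨2 * L, by linarith [hg.nonneg]⟩ : ℝ≥0)
    (fun t => LipschitzWith.of_dist_le_mul fun a b => ?_) fun a => hg.continuous_time a.1 a.2
  rw [dist_eq_norm, dist_eq_norm]
  refine (hg.lipschitz t a.1 a.2 b.1 b.2).trans ?_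
  have h₁ : ‖a.1 - b.1‖ ≤ ‖a - b‖ := norm_fst_le (a - b)
  have h₂ : ‖a.2 - b.2‖ ≤ ‖a - b‖ := norm_snd_le (a - b)
  change _ ≤ 2 * L * ‖a - b‖
  nlinarith [hg.nonneg]

theorem stronglyMeasurable_source (hg : IsAdmissible g L H) (hβ : Monotone β)
    {z : ℝ → X} (hz : Continuous z) : StronglyMeasurable (source g β z) :=
  hg.continuous_uncurry.comp_stronglyMeasurable (stronglyMeasurable_id.prodMk
    (hz.stronglyMeasurable.prodMk (hz.stronglyMeasurable.comp_measurable hβ.measurable)))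

theorem continuousWithinAt_source (hg : IsAdmissible g L H) {z : ℝ → X} (hz : Continuous z)
    {S : Set ℝ} {t : ℝ} (hβ : ∀ᶠ s in 𝓝[S] t, β s = β t) :
    ContinuousWithinAt (source g β z) S t := by
  have h : Continuous fun s => g s (z s) (z (β t)) :=
    hg.continuous_uncurry.comp (continuous_id.prodMk (hz.prodMk continuous_const))
  refine h.continuousWithinAt.congr_of_eventuallyEq ?_ rfl
  filter_upwards [hβ] with s hs
  simp only [source, hs]

theorem norm_source_sub_le (hg : IsAdmissible g L H) (z w : ℝ →ᵇ X) (s : ℝ) :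
    ‖source g β z s - source g β w s‖ ≤ 2 * L * dist z w := by
  refine (hg.lipschitz s _ _ _ _).trans ?_
  have h (r : ℝ) : ‖z r - w r‖ ≤ dist z w := by
    rw [← dist_eq_norm]; exact BoundedContinuousFunction.dist_coe_le_dist r
  nlinarith [hg.nonneg, h s, h (β s)]

theorem norm_source_le (hg : IsAdmissible g L H) (z : ℝ →ᵇ X) (s : ℝ) :
    ‖source g β z s‖ ≤ 2 * L * dist z 0 + H := by
  have h₁ := hg.norm_source_sub_le (β := β) z 0 s
  have h₂ : ‖source g β (0 : ℝ →ᵇ X) s‖ ≤ H := by simpa [source] using hg.bound s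
  calc ‖source g β z s‖
      = ‖(source g β z s - source g β (0 : ℝ →ᵇ X) s) + source g β (0 : ℝ →ᵇ X) s‖ := by
        rw [sub_add_cancel]
    _ ≤ _ := norm_add_le_of_le h₁ h₂

end IsAdmissible

end Source

section Partition

variable {θ : ℤ → ℝ} {β : ℝ → ℝ}

theorem exists_int_mem_Ico (hθ : StrictMono θ) (htop : Tendsto θ atTop atTop)
    (hbot : Tendsto θ atBot atBot) (t : ℝ) : ∃ i : ℤ, t ∈ Ico (θ i) (θ (i + 1)) := by
  obtain ⟨a, ha⟩ := (hbot.eventually_le_atBot t).exists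
  obtain ⟨b, hb⟩ := (htop.eventually_gt_atTop t).exists
  obtain ⟨i, hi, hmax⟩ := Int.exists_greatest_of_bdd (P := fun i => θ i ≤ t)
    ⟨b, fun j hj => (hθ.lt_iff_lt.1 (hj.trans_lt hb)).le⟩ ⟨a, ha⟩
  exact ⟨i, hi, lt_of_not_ge fun h => (lt_add_one i).not_ge (hmax _ h)⟩

theorem monotone_of_eq_on_Ico (hθ : StrictMono θ) (hex : ∀ t, ∃ i : ℤ, t ∈ Ico (θ i) (θ (i + 1)))
    (hβ : ∀ i : ℤ, ∀ t ∈ Ico (θ i) (θ (i + 1)), β t = θ i) : Monotone β := by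
  intro s t hst
  obtain ⟨i, hi⟩ := hex s
  obtain ⟨j, hj⟩ := hex t
  rw [hβ i s hi, hβ j t hj]
  exact hθ.monotone (Int.lt_add_one_iff.1 (hθ.lt_iff_lt.1 (hi.1.trans_lt (hst.trans_lt hj.2))))

theorem eventually_nhdsGT_eq (hex : ∀ t, ∃ i : ℤ, t ∈ Ico (θ i) (θ (i + 1)))
    (hβ : ∀ i : ℤ, ∀ t ∈ Ico (θ i) (θ (i + 1)), β t = θ i) (t : ℝ) :
    ∀ᶠ s in 𝓝[>] t, β s = β t := by
  obtain ⟨i, hi⟩ := hex t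
  filter_upwards [Ioo_mem_nhdsGT hi.2] with s hs
  rw [hβ i t hi, hβ i s ⟨hi.1.trans hs.1.le, hs.2⟩]

theorem eventually_nhds_eq (hex : ∀ t, ∃ i : ℤ, t ∈ Ico (θ i) (θ (i + 1)))
    (hβ : ∀ i : ℤ, ∀ t ∈ Ico (θ i) (θ (i + 1)), β t = θ i) {t : ℝ} (ht : t ∉ range θ) :
    ∀ᶠ s in 𝓝 t, β s = β t := by
  obtain ⟨i, hi⟩ := hex t
  filter_upwards [Ioo_mem_nhds (hi.1.lt_of_ne fun h => ht ⟨i, h⟩) hi.2] with s hs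
  rw [hβ i t hi, hβ i s ⟨hs.1.le, hs.2⟩]

theorem apply_add_mul_period {p : ℕ} {T : ℝ} (hθT : ∀ i : ℤ, θ (i + p) = θ i + T) (q : ℕ) (i : ℤ) :
    θ (i + q * p) = θ i + q * T := by
  induction q with
  | zero => simp
  | succ q ih =>
    have h := hθT (i + q * p)
    rw [ih] at h
    push_cast
    rw [show i + ((q : ℤ) + 1) * p = i + q * p + p by ring, h]
    ring

theorem beta_add_period (hex : ∀ t, ∃ i : ℤ, t ∈ Ico (θ i) (θ (i + 1)))
    (hβ : ∀ i : ℤ, ∀ t ∈ Ico (θ i) (θ (i + 1)), β t = θ i) {d : ℤ} {T : ℝ}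
    (hθT : ∀ i : ℤ, θ (i + d) = θ i + T) (t : ℝ) : β (t + T) = β t + T := by
  obtain ⟨i, hi⟩ := hex t
  rw [hβ i t hi, ← hθT i]
  refine hβ (i + d) (t + T) ⟨?_, ?_⟩
  · linarith [hθT i, hi.1]
  · rw [add_right_comm, hθT]
    linarith [hi.2]

end Partition

section GreenOperator

variable {E F : Type*} [NormedAddCommGroup E] [NormedSpace ℝ E] [NormedAddCommGroup F]
  [NormedSpace ℝ F]

/-- The integral operator whose bounded continuous fixed points are the bounded solutions of the
dichotomous system. -/
def greenOp (U : ℝ → ℝ → E →L[ℝ] E) (V : ℝ → ℝ → F →L[ℝ] F) (β : ℝ → ℝ)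
    (gp : ℝ → E × F → E × F → E) (gm : ℝ → E × F → E × F → F) (z : ℝ → E × F) (t : ℝ) : E × F :=
  (response U Iic (source gp β z) t, -response V Ioi (source gm β z) t)

variable {U : ℝ → ℝ → E →L[ℝ] E} {V : ℝ → ℝ → F →L[ℝ] F} {β : ℝ → ℝ}
  {gp : ℝ → E × F → E × F → E} {gm : ℝ → E × F → E × F → F}

theorem greenOp_comp_add {T : ℝ} (hUT : ∀ t s, U (t + T) (s + T) = U t s)
    (hVT : ∀ t s, V (t + T) (s + T) = V t s) (hgpT : ∀ t z w, gp (t + T) z w = gp t z w)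
    (hgmT : ∀ t z w, gm (t + T) z w = gm t z w) (hβT : ∀ t, β (t + T) = β t + T)
    (z : ℝ → E × F) (t : ℝ) :
    greenOp U V β gp gm (fun s => z (s + T)) t = greenOp U V β gp gm z (t + T) := by
  have h₁ : source gp β (fun s => z (s + T)) = fun s => source gp β z (s + T) :=
    funext (source_comp_add hgpT hβT z)
  have h₂ : source gm β (fun s => z (s + T)) = fun s => source gm β z (s + T) :=
    funext (source_comp_add hgmT hβT z)
  simp only [greenOp, h₁, h₂]
  rw [response_add hUT (fun t => by ext; simp), response_add hVT (fun t => by ext; simp)]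

variable [CompleteSpace E] [CompleteSpace F] {Bp : ℝ → E →L[ℝ] E} {Bm : ℝ → F →L[ℝ] F}
  {M κ L H : ℝ}

theorem existsUnique_greenOp_fixedPoint (hU : IsTransition Bp U) (hV : IsTransition Bm V)
    (hBp : ∀ t, ‖Bp t‖ ≤ M) (hBm : ∀ t, ‖Bm t‖ ≤ M) (hκ : 0 ≤ κ)
    (hUκ : HasKernelBound U Iic κ) (hVκ : HasKernelBound V Ioi κ) (hβ : Monotone β)
    (hgp : IsAdmissible gp L H) (hgm : IsAdmissible gm L H) (hsmall : κ * (2 * L) < 1) :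
    ∃! z : ℝ →ᵇ E × F, greenOp U V β gp gm z = z := by
  have hmp (z : ℝ →ᵇ E × F) := hgp.stronglyMeasurable_source hβ z.continuous
  have hmm (z : ℝ →ᵇ E × F) := hgm.stronglyMeasurable_source hβ z.continuous
  have hcont (z : ℝ →ᵇ E × F) : Continuous (greenOp U V β gp gm z) := by
    refine Continuous.prodMk ?_ ?_
    · rw [funext (response_Iic_eq hUκ hU hBp (hmp z) (hgp.norm_source_le z))]
      exact hU.continuous_variation hBp (hmp z) (hgp.norm_source_le z) _
    · rw [funext (neg_response_Ioi_eq hVκ hV hBm (hmm z) (hgm.norm_source_le z))]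
      exact hV.continuous_variation hBm (hmm z) (hgm.norm_source_le z) _
  have hbound (z : ℝ →ᵇ E × F) (t : ℝ) :
      ‖greenOp U V β gp gm z t‖ ≤ κ * (2 * L * dist z 0 + H) :=
    norm_prod_le_iff.2 ⟨hUκ.norm_response_le (hgp.norm_source_le z) t,
      (norm_neg _).trans_le (hVκ.norm_response_le (hgm.norm_source_le z) t)⟩
  let Φ (z : ℝ →ᵇ E × F) : ℝ →ᵇ E × F :=
    BoundedContinuousFunction.ofNormedAddCommGroup _ (hcont z) _ (hbound z)
  have hΦ : ContractingWith ⟨κ * (2 * L), mul_nonneg hκ (by linarith [hgp.nonneg])⟩ Φ := by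
    refine ⟨by exact_mod_cast hsmall, LipschitzWith.of_dist_le_mul fun z w => ?_⟩
    change _ ≤ κ * (2 * L) * dist z w
    rw [BoundedContinuousFunction.dist_le
      (mul_nonneg (mul_nonneg hκ (by linarith [hgp.nonneg])) dist_nonneg)]
    intro t
    change dist (greenOp U V β gp gm z t) (greenOp U V β gp gm w t) ≤ _
    rw [dist_eq_norm, mul_assoc]
    refine norm_prod_le_iff.2 ⟨?_, ?_⟩
    · change ‖response U Iic _ t - response U Iic _ t‖ ≤ _
      rw [hUκ.response_sub hU hBp (hmp z) (hgp.norm_source_le z) (hmp w) (hgp.norm_source_le w)]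
      exact hUκ.norm_response_le (hgp.norm_source_sub_le z w) t
    · change ‖-response V Ioi _ t - -response V Ioi _ t‖ ≤ _
      rw [neg_sub_neg, norm_sub_rev,
        hVκ.response_sub hV hBm (hmm z) (hgm.norm_source_le z) (hmm w) (hgm.norm_source_le w)]
      exact hVκ.norm_response_le (hgm.norm_source_sub_le z w) t
  refine ⟨ContractingWith.fixedPoint Φ hΦ, ?_, fun z hz => hΦ.fixedPoint_unique ?_⟩
  · exact congrArg DFunLike.coe hΦ.fixedPoint_isFixedPt
  · exact DFunLike.coe_injective hz

theorem hasDerivWithinAt_of_greenOp_eq (hU : IsTransition Bp U) (hV : IsTransition Bm V)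
    (hBp : ∀ t, ‖Bp t‖ ≤ M) (hBm : ∀ t, ‖Bm t‖ ≤ M)
    (hUκ : HasKernelBound U Iic κ) (hVκ : HasKernelBound V Ioi κ) (hβ : Monotone β)
    (hgp : IsAdmissible gp L H) (hgm : IsAdmissible gm L H) {z : ℝ →ᵇ E × F}
    (hz : greenOp U V β gp gm z = z) {t : ℝ} {S S' : Set ℝ}
    [intervalIntegral.FTCFilter t (𝓝[S] t) (𝓝[S'] t)] (hβt : ∀ᶠ s in 𝓝[S'] t, β s = β t) :
    HasDerivWithinAt (fun s => (z s).1) (Bp t (z t).1 + gp t (z t) (z (β t))) S t ∧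
      HasDerivWithinAt (fun s => (z s).2) (Bm t (z t).2 + gm t (z t) (z (β t))) S t := by
  have hmp := hgp.stronglyMeasurable_source hβ z.continuous
  have hmm := hgm.stronglyMeasurable_source hβ z.continuous
  have h₁ (s : ℝ) : (z s).1 = _ := (congrArg Prod.fst (congrFun hz s)).symm.trans
    (response_Iic_eq hUκ hU hBp hmp (hgp.norm_source_le z) s)
  have h₂ (s : ℝ) : (z s).2 = _ := (congrArg Prod.snd (congrFun hz s)).symm.trans
    (neg_response_Ioi_eq hVκ hV hBm hmm (hgm.norm_source_le z) s)
  constructor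
  · have h := hU.hasDerivWithinAt_variation hBp hmp (hgp.norm_source_le z)
      (∫ s in Iic 0, U 0 s (source gp β z s)) (S := S)
      (hgp.continuousWithinAt_source z.continuous hβt)
    simp only [← h₁] at h
    exact h
  · have h := hV.hasDerivWithinAt_variation hBm hmm (hgm.norm_source_le z)
      (-∫ s in Ioi 0, V 0 s (source gm β z s)) (S := S)
      (hgm.continuousWithinAt_source z.continuous hβt)
    simp only [← h₂] at h
    exact h

end GreenOperator

theorem stmt_16
    (k m : ℕ) (hk : 1 ≤ k) (hm : 1 ≤ m)
    (θ : ℤ → ℝ) (hθmono : StrictMono θ)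
    (θb : ℝ) (hθb : 0 < θb) (hgap : ∀ i : ℤ, θ (i + 1) - θ i ≤ θb)
    (hθtop : Tendsto θ atTop atTop) (hθbot : Tendsto θ atBot atBot)
    (β : ℝ → ℝ) (hβ : ∀ (i : ℤ) (t : ℝ), θ i ≤ t → t < θ (i + 1) → β t = θ i)
    (Bp : ℝ → Ek k →L[ℝ] Ek k) (Bm : ℝ → Ek m →L[ℝ] Ek m)
    (hBp : Continuous Bp) (hBm : Continuous Bm)
    (U : ℝ → ℝ → Ek k →L[ℝ] Ek k) (V : ℝ → ℝ → Ek m →L[ℝ] Ek m)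
    (hUid : ∀ s : ℝ, U s s = ContinuousLinearMap.id ℝ (Ek k))
    (hVid : ∀ s : ℝ, V s s = ContinuousLinearMap.id ℝ (Ek m))
    (hUderiv : ∀ s t : ℝ, HasDerivAt (fun r => U r s) ((Bp t).comp (U t s)) t)
    (hVderiv : ∀ s t : ℝ, HasDerivAt (fun r => V r s) ((Bm t).comp (V t s)) t)
    (K σ : ℝ) (hK : 1 ≤ K) (hσ : 0 < σ)
    (hU : ∀ s t : ℝ, s ≤ t → ‖U t s‖ ≤ K * Real.exp (-σ * (t - s)))
    (hV : ∀ s t : ℝ, t ≤ s → ‖V t s‖ ≤ K * Real.exp (-σ * (s - t)))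
    (gp : ℝ → Ek k × Ek m → Ek k × Ek m → Ek k)
    (gm : ℝ → Ek k × Ek m → Ek k × Ek m → Ek m)
    (hgpc : ∀ zz ww, Continuous fun t => gp t zz ww)
    (hgmc : ∀ zz ww, Continuous fun t => gm t zz ww)
    (L : ℝ) (hL : 0 < L)
    (hlip : ∀ (t : ℝ) (z₁ w₁ z₂ w₂ : Ek k × Ek m),
      ‖gp t z₁ w₁ - gp t z₂ w₂‖ + ‖gm t z₁ w₁ - gm t z₂ w₂‖ ≤
        L * (‖z₁ - z₂‖ + ‖w₁ - w₂‖))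
    (μ : ℝ) (hμ : ∀ t : ℝ, ‖Bp t‖ ≤ μ ∧ ‖Bm t‖ ≤ μ)
    (hbw : L * Real.exp (μ * θb) * θb *
        (1 + Real.exp (μ * θb) * (1 + L * θb) * Real.exp (Real.exp (μ * θb) * L * θb)) <
      Real.exp (-(μ * θb)))
    (H : ℝ) (hH : 0 < H)
    (hgb : ∀ t : ℝ, ‖gp t 0 0‖ ≤ H ∧ ‖gm t 0 0‖ ≤ H)
    (hsmall : 2 * K * L / σ < 1)
    (ω : ℝ) (hω : 0 < ω)
    (hBper : ∀ t : ℝ, Bp (t + ω) = Bp t ∧ Bm (t + ω) = Bm t)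
    (hgper : ∀ (t : ℝ) (zz ww : Ek k × Ek m),
      gp (t + ω) zz ww = gp t zz ww ∧ gm (t + ω) zz ww = gm t zz ww)
    (ωb : ℝ) (hωb : 0 < ωb) (p : ℕ) (hp : 0 < p)
    (hθper : ∀ i : ℤ, θ (i + (p : ℤ)) = θ i + ωb)
    (k₀ m₀ : ℕ) (hk₀ : 0 < k₀) (hm₀ : 0 < m₀)
    (hratio : ω / ωb = (k₀ : ℝ) / (m₀ : ℝ)) :
    ∃ z : ℝ → Ek k × Ek m,
      SolOn θ β Bp Bm gp gm z Set.univ ∧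
      ∀ t : ℝ, z (t + (m₀ : ℝ) * ω) = z t := by
  have hex := exists_int_mem_Ico hθmono hθtop hθbot
  have hβ' : ∀ i : ℤ, ∀ t ∈ Ico (θ i) (θ (i + 1)), β t = θ i := fun i t ht => hβ i t ht.1 ht.2
  have hβmono := monotone_of_eq_on_Ico hθmono hex hβ'
  have hUt : IsTransition Bp U := ⟨hUid, hUderiv⟩
  have hVt : IsTransition Bm V := ⟨hVid, hVderiv⟩
  have hBpμ (t : ℝ) := (hμ t).1
  have hBmμ (t : ℝ) := (hμ t).2
  have hgpa : IsAdmissible gp L H := ⟨hgpc, fun t z₁ w₁ z₂ w₂ =>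
    (le_add_of_nonneg_right (norm_nonneg _)).trans (hlip t z₁ w₁ z₂ w₂), fun t => (hgb t).1, hL.le⟩
  have hgma : IsAdmissible gm L H := ⟨hgmc, fun t z₁ w₁ z₂ w₂ =>
    (le_add_of_nonneg_left (norm_nonneg _)).trans (hlip t z₁ w₁ z₂ w₂), fun t => (hgb t).2, hL.le⟩
  have hUκ := hasKernelBound_Iic hσ hU
  have hVκ := hasKernelBound_Ioi hσ hV
  have hκ : 0 ≤ K / σ := div_nonneg (zero_le_one.trans hK) hσ.le
  have hsmall' : K / σ * (2 * L) < 1 := by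
    rwa [show K / σ * (2 * L) = 2 * K * L / σ by ring]
  obtain ⟨z, hz, huniq⟩ := existsUnique_greenOp_fixedPoint hUt hVt hBpμ hBmμ hκ hUκ hVκ hβmono
    hgpa hgma hsmall'
  have hT : (m₀ : ℝ) * ω = k₀ * ωb := by
    have hm : (m₀ : ℝ) ≠ 0 := by positivity
    field_simp at hratio
    linarith
  have hβT : ∀ t, β (t + m₀ * ω) = β t + m₀ * ω :=
    beta_add_period hex hβ' (d := k₀ * p) fun i => by rw [hT, apply_add_mul_period hθper]
  have hUT := hUt.add_add_eq hBpμ (Function.Periodic.nat_mul (fun t => (hBper t).1) m₀)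
  have hVT := hVt.add_add_eq hBmμ (Function.Periodic.nat_mul (fun t => (hBper t).2) m₀)
  have hgpT (t : ℝ) (a b : Ek k × Ek m) : gp (t + m₀ * ω) a b = gp t a b :=
    Function.Periodic.nat_mul (f := fun t => gp t a b) (fun t => (hgper t a b).1) m₀ t
  have hgmT (t : ℝ) (a b : Ek k × Ek m) : gm (t + m₀ * ω) a b = gm t a b :=
    Function.Periodic.nat_mul (f := fun t => gm t a b) (fun t => (hgper t a b).2) m₀ t
  refine ⟨z, ⟨z.continuous.continuousOn, fun t _ => ⟨?_, fun ht => ?_⟩⟩, fun t => ?_⟩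
  · rw [inter_univ]
    exact hasDerivWithinAt_of_greenOp_eq hUt hVt hBpμ hBmμ hUκ hVκ hβmono hgpa hgma hz
      (S' := Ioi t) (eventually_nhdsGT_eq hex hβ' t)
  · have : intervalIntegral.FTCFilter t (𝓝[univ] t) (𝓝[univ] t) := by
      rw [nhdsWithin_univ]; infer_instance
    exact hasDerivWithinAt_of_greenOp_eq hUt hVt hBpμ hBmμ hUκ hVκ hβmono hgpa hgma hz
      (S' := univ) (by rw [nhdsWithin_univ]; exact eventually_nhds_eq hex hβ' ht)
  · have hshift := huniq (z.compContinuous ⟨fun s => s + m₀ * ω, by fun_prop⟩)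
      (funext fun s => (greenOp_comp_add hUT hVT hgpT hgmT hβT z s).trans (congrFun hz _))
    exact DFunLike.congr_fun hshift t
end
end
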